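/- Let h be a 2×1×1 degenerated tripartite quartic form written as h(x₁, x₂, y, z) = h_2(x₁,x₂)z² + h_3(x₁,x₂)yz + h_4(x₁,x₂)y² + h_5(x₁,x₂)yz² + h_6(x₁,x₂)y²z + h_7 y²z², where h_2, h_3, h_4 are binary quadratic forms, h_5, h_6 are binary linear forms and h_7 ∈ ℝ, and suppose h is positive semidefinite with h_7 = 0. Then h_5 and h_6 are identically zero, so h(x₁,x₂,y,z) = h_2(x₁,x₂)z² + h_3(x₁,x₂)yz + h_4(x₁,x₂)y² is a 2×2 positive semidefinite biquadratic form in the variable blocks (x₁,x₂) and (y,z), and h can be expressed as a sum of at most 3 squares of bilinear forms b((x₁,x₂),(y,z)). -/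

import Mathlib

/-- `F` is a sum of three squares of bilinear forms in the blocks `(x₁, x₂)` and `(y, z)`. -/
def IsSumThreeSq (F : ℝ → ℝ → ℝ → ℝ → ℝ) : Prop :=
  ∃ c : Fin 3 → Fin 2 → Fin 2 → ℝ, ∀ x1 x2 y z, F x1 x2 y z =
    ∑ t, (∑ i, ∑ k, c t i k * ![x1, x2] i * ![y, z] k) ^ 2

/-- The binary quadratic form with Gram matrix `[[a, b], [b, c]]`. -/
def qform (a b c x1 x2 : ℝ) : ℝ := a * x1 ^ 2 + 2 * b * (x1 * x2) + c * x2 ^ 2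

/-- The 2×2 biquadratic form whose coefficients are the binary quadratic forms with the given
Gram matrices. -/
def biquad (a11 a12 a22 b11 b12 b22 c11 c12 c22 x1 x2 y z : ℝ) : ℝ :=
  qform a11 a12 a22 x1 x2 * y ^ 2 + 2 * qform b11 b12 b22 x1 x2 * (y * z)
    + qform c11 c12 c22 x1 x2 * z ^ 2

theorem isSumThreeSq_of_eq {F : ℝ → ℝ → ℝ → ℝ → ℝ}
    (a1 a2 a3 a4 b1 b2 b3 b4 c1 c2 c3 c4 : ℝ)
    (hF : ∀ x1 x2 y z, F x1 x2 y z =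
      (a1 * x1 * y + a2 * x1 * z + (a3 * x2 * y + a4 * x2 * z)) ^ 2
        + (b1 * x1 * y + b2 * x1 * z + (b3 * x2 * y + b4 * x2 * z)) ^ 2
        + (c1 * x1 * y + c2 * x1 * z + (c3 * x2 * y + c4 * x2 * z)) ^ 2) :
    IsSumThreeSq F := by
  refine ⟨![![![a1, a2], ![a3, a4]], ![![b1, b2], ![b3, b4]], ![![c1, c2], ![c3, c4]]], ?_⟩
  intro x1 x2 y z
  simp [Fin.sum_univ_three, hF]

theorem IsSumThreeSq.comp_linear {F : ℝ → ℝ → ℝ → ℝ → ℝ} (hF : IsSumThreeSq F) (p q r s : ℝ) :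
    IsSumThreeSq fun x1 x2 y z => F (p * x1 + q * x2) (r * x1 + s * x2) y z := by
  obtain ⟨c, hc⟩ := hF
  refine ⟨fun t i k => c t 0 k * ![p, q] i + c t 1 k * ![r, s] i, ?_⟩
  intro x1 x2 y z
  simp only [hc, Fin.sum_univ_two, Fin.sum_univ_three, Matrix.cons_val_zero, Matrix.cons_val_one]
  ring

theorem isSumThreeSq_of_comp_linear {F : ℝ → ℝ → ℝ → ℝ → ℝ} {p q r s : ℝ}
    (hdet : p * s - q * r ≠ 0)
    (hF : IsSumThreeSq fun x1 x2 y z => F (p * x1 + q * x2) (r * x1 + s * x2) y z) :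
    IsSumThreeSq F := by
  set D := p * s - q * r with hD
  convert hF.comp_linear (s / D) (-q / D) (-r / D) (p / D) using 5 with x1 x2 y z
  · field_simp
    rw [hD]; ring
  · field_simp
    rw [hD]; ring

theorem biquad_comp_linear (a11 a12 a22 b11 b12 b22 c11 c12 c22 p q r s x1 x2 y z : ℝ) :
    biquad a11 a12 a22 b11 b12 b22 c11 c12 c22 (p * x1 + q * x2) (r * x1 + s * x2) y z =
      biquad (qform a11 a12 a22 p r) (a11 * p * q + a12 * (p * s + q * r) + a22 * r * s)
        (qform a11 a12 a22 q s)
        (qform b11 b12 b22 p r) (b11 * p * q + b12 * (p * s + q * r) + b22 * r * s)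
        (qform b11 b12 b22 q s)
        (qform c11 c12 c22 p r) (c11 * p * q + c12 * (p * s + q * r) + c22 * r * s)
        (qform c11 c12 c22 q s) x1 x2 y z := by
  simp only [biquad, qform]
  ring

theorem qform_nonneg_iff {a b c : ℝ} :
    (∀ x1 x2, 0 ≤ qform a b c x1 x2) ↔ 0 ≤ a ∧ 0 ≤ c ∧ b ^ 2 ≤ a * c := by
  constructor
  · intro h
    have ha : 0 ≤ a := by simpa [qform] using h 1 0
    have hc : 0 ≤ c := by simpa [qform] using h 0 1
    refine ⟨ha, hc, ?_⟩
    have := discrim_le_zero (a := a) (b := 2 * b) (c := c) fun x => by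
      have := h x 1
      simp only [qform] at this
      linarith
    rw [discrim] at this
    linarith
  · rintro ⟨ha, hc, hb⟩ x1 x2
    rcases ha.eq_or_lt with rfl | ha
    · obtain rfl : b = 0 := by nlinarith
      have : qform 0 0 c x1 x2 = c * x2 ^ 2 := by simp only [qform]; ring
      rw [this]
      positivity
    · refine nonneg_of_mul_nonneg_right ?_ ha
      have : a * qform a b c x1 x2 = (a * x1 + b * x2) ^ 2 + (a * c - b ^ 2) * x2 ^ 2 := by
        simp only [qform]; ring
      rw [this]
      have : 0 ≤ a * c - b ^ 2 := by linarith
      positivity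

/-- Cholesky decomposition of a 2×2 positive semidefinite matrix. -/
theorem exists_cholesky {a b c : ℝ} (ha : 0 ≤ a) (hc : 0 ≤ c) (hb : b ^ 2 ≤ a * c) :
    ∃ r s w : ℝ, a = r ^ 2 ∧ b = r * s ∧ c = s ^ 2 + w ^ 2 ∧ a * c - b ^ 2 = (r * w) ^ 2 := by
  rcases ha.eq_or_lt with rfl | ha
  · obtain rfl : b = 0 := by nlinarith
    exact ⟨0, 0, √c, by simp, by simp, by simp [Real.sq_sqrt hc], by simp⟩
  · have hr : √a ^ 2 = a := Real.sq_sqrt ha.le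
    have hr0 : √a ≠ 0 := (Real.sqrt_pos.2 ha).ne'
    have hw : 0 ≤ c - b ^ 2 / a := by
      rw [sub_nonneg, div_le_iff₀ ha]; linarith
    have hs : (b / √a) ^ 2 = b ^ 2 / a := by rw [div_pow, hr]
    refine ⟨√a, b / √a, √(c - b ^ 2 / a), hr.symm, by field_simp, ?_, ?_⟩
    · rw [Real.sq_sqrt hw, hs]; ring
    · rw [mul_pow, Real.sq_sqrt hw, hr]; field_simp

theorem exists_eq_mul_of_sq_eq {a b c : ℝ} (ha : 0 ≤ a) (hc : 0 ≤ c) (hb : b ^ 2 = a * c) :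
    ∃ r s : ℝ, a = r ^ 2 ∧ b = r * s ∧ c = s ^ 2 := by
  obtain ⟨r, s, w, h1, h2, h3, h4⟩ := exists_cholesky ha hc hb.le
  have hrw : r * w = 0 := by
    rw [← sq_eq_zero_iff, ← h4]; linarith
  rcases mul_eq_zero.1 hrw with rfl | rfl
  · exact ⟨0, √c, by simpa using h1, by simpa using h2, (Real.sq_sqrt hc).symm⟩
  · exact ⟨r, s, h1, h2, by simpa using h3⟩

theorem tendsto_add_sq_add_cocompact (b e : ℝ) :
    Filter.Tendsto (fun y : ℝ => (y + b) ^ 2 + e) (Filter.cocompact ℝ) Filter.atTop := by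
  have h : Filter.Tendsto (fun y : ℝ => ‖y + b‖ ^ 2) (Filter.cocompact ℝ) Filter.atTop :=
    (Filter.tendsto_pow_atTop two_ne_zero).comp
      ((tendsto_norm_cocompact_atTop (E := ℝ)).comp
        (Homeomorph.addRight b).isClosedEmbedding.tendsto_cocompact)
  simpa using Filter.tendsto_atTop_add_const_right _ e h

/-- First order condition and a global second order condition at the minimum of a product of two
monic quadratic polynomials. -/
theorem minimum_conditions {u v q1 q2 : ℝ}
    (h : ∀ s, q1 * q2 ≤ (q1 + 2 * u * s + s ^ 2) * (q2 + 2 * v * s + s ^ 2)) :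
    u * q2 + v * q1 = 0 ∧ (u - v) ^ 2 ≤ q1 + q2 := by
  have hw : u * q2 + v * q1 = 0 := by
    have hmin : IsLocalMin (fun s : ℝ => (q1 + 2 * u * s + s ^ 2) * (q2 + 2 * v * s + s ^ 2)) 0 :=
      Filter.Eventually.of_forall fun s => by simpa using h s
    have hd : HasDerivAt (fun s : ℝ => (q1 + 2 * u * s + s ^ 2) * (q2 + 2 * v * s + s ^ 2))
        (2 * u * q2 + q1 * (2 * v)) 0 := by
      have h1 : ∀ q w : ℝ, HasDerivAt (fun s : ℝ => q + 2 * w * s + s ^ 2) (2 * w) 0 := by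
        intro q w
        have := (((hasDerivAt_id (0 : ℝ)).const_mul (2 * w)).const_add q).add
          ((hasDerivAt_id (0 : ℝ)).pow 2)
        exact this.congr_deriv (by norm_num)
      exact ((h1 q1 u).mul (h1 q2 v)).congr_deriv (by norm_num)
    have := hmin.hasDerivAt_eq_zero hd
    linarith
  refine ⟨hw, ?_⟩
  have hs : ∀ s : ℝ, s ≠ 0 → 0 ≤ (s + (u + v)) ^ 2 + (q1 + q2 - (u - v) ^ 2) := by
    intro s hs0
    have hs2 : 0 < s ^ 2 := by positivity
    refine nonneg_of_mul_nonneg_right ?_ hs2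
    have := h s
    linear_combination this + 2 * s * hw
  have hcont : Continuous fun s : ℝ => (s + (u + v)) ^ 2 + (q1 + q2 - (u - v) ^ 2) := by fun_prop
  have hcl : ∀ s : ℝ, 0 ≤ (s + (u + v)) ^ 2 + (q1 + q2 - (u - v) ^ 2) := by
    have hdense : Dense ({0}ᶜ : Set ℝ) := dense_compl_singleton 0
    intro s
    exact (isClosed_le continuous_const hcont).closure_subset_iff.2
      (fun s (h : s ∈ ({0}ᶜ : Set ℝ)) => hs s h) (hdense s)
  have := hcl (-(u + v))
  simp only [neg_add_cancel] at this
  linarith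

/-- If `((y + b₁)² + e₁)((y + b₂)² + e₂) - c²` is nonnegative, the one-parameter family of
Gram matrices contains a positive semidefinite one. -/
theorem exists_gram_nonneg {b1 b2 e1 e2 c : ℝ} (he1 : 0 ≤ e1) (he2 : 0 ≤ e2)
    (h : ∀ y, c ^ 2 ≤ ((y + b1) ^ 2 + e1) * ((y + b2) ^ 2 + e2)) :
    ∃ t : ℝ, t ^ 2 ≤ e1 ∧ t ^ 2 ≤ e2 ∧
      (c - t * (b1 - b2)) ^ 2 ≤ (e1 - t ^ 2) * (e2 - t ^ 2) := by
  obtain ⟨y, hy⟩ := (show Continuous fun y : ℝ => ((y + b1) ^ 2 + e1) * ((y + b2) ^ 2 + e2) by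
    fun_prop).exists_forall_le
      ((tendsto_add_sq_add_cocompact b1 e1).atTop_mul_atTop₀ (tendsto_add_sq_add_cocompact b2 e2))
  obtain ⟨u, hu⟩ : ∃ u, u = y + b1 := ⟨_, rfl⟩
  obtain ⟨v, hv⟩ : ∃ v, v = y + b2 := ⟨_, rfl⟩
  obtain ⟨q1, hq1⟩ : ∃ q1, q1 = u ^ 2 + e1 := ⟨_, rfl⟩
  obtain ⟨q2, hq2⟩ : ∃ q2, q2 = v ^ 2 + e2 := ⟨_, rfl⟩
  have hc : c ^ 2 ≤ q1 * q2 := by simpa only [hq1, hq2, hu, hv] using h y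
  obtain ⟨hw, hglob⟩ := minimum_conditions (u := u) (v := v) (q1 := q1) (q2 := q2) fun s => by
    have := hy (y + s)
    simp only [hq1, hq2, hu, hv]
    linarith
  have hd : b1 - b2 = u - v := by rw [hu, hv]; ring
  have hq1n : 0 ≤ q1 := by rw [hq1]; positivity
  have hq2n : 0 ≤ q2 := by rw [hq2]; positivity
  rcases hq1n.eq_or_lt with h0 | hq1p
  · obtain rfl : c = 0 := by
      rw [← h0] at hc; nlinarith
    exact ⟨0, by simpa using he1, by simpa using he2, by simpa using mul_nonneg he1 he2⟩
  obtain ⟨k, hk⟩ : ∃ k, u = k * q1 := ⟨u / q1, by field_simp⟩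
  have hvk : v = -(k * q2) := by
    have : q1 * (v + k * q2) = 0 := by rw [hk] at hw; linarith
    rcases mul_eq_zero.1 this with h | h
    · exact absurd h hq1p.ne'
    · linarith
  have hm : 0 ≤ 1 - k ^ 2 * (q1 + q2) := by
    have hS : 0 < q1 + q2 := by linarith
    refine nonneg_of_mul_nonneg_right ?_ hS
    rw [hk, hvk] at hglob
    linarith
  have hk2 : k ^ 2 * c ^ 2 ≤ k ^ 2 * (q1 * q2) := mul_le_mul_of_nonneg_left hc (sq_nonneg k)
  have h1 : q1 * (1 - k ^ 2 * (q1 + q2)) ≤ e1 - (k * c) ^ 2 := by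
    have : e1 = q1 - (k * q1) ^ 2 := by rw [← hk]; linarith
    rw [this]; linarith
  have h2 : q2 * (1 - k ^ 2 * (q1 + q2)) ≤ e2 - (k * c) ^ 2 := by
    have : e2 = q2 - (k * q2) ^ 2 := by rw [hvk] at hq2; linarith
    rw [this]; linarith
  have h1n := mul_nonneg hq1n hm
  have h2n := mul_nonneg hq2n hm
  refine ⟨k * c, by linarith, by linarith, ?_⟩
  calc (c - k * c * (b1 - b2)) ^ 2 = c ^ 2 * (1 - k ^ 2 * (q1 + q2)) ^ 2 := by
        rw [hd, hk, hvk]; ring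
    _ ≤ q1 * q2 * (1 - k ^ 2 * (q1 + q2)) ^ 2 := mul_le_mul_of_nonneg_right hc (sq_nonneg _)
    _ = q1 * (1 - k ^ 2 * (q1 + q2)) * (q2 * (1 - k ^ 2 * (q1 + q2))) := by ring
    _ ≤ _ := mul_le_mul h1 h2 h2n (h1n.trans h1)

/-- Under the same hypothesis the family even contains a singular positive semidefinite Gram
matrix. -/
theorem exists_gram_singular {b1 b2 e1 e2 c : ℝ} (he1 : 0 ≤ e1) (he2 : 0 ≤ e2)
    (h : ∀ y, c ^ 2 ≤ ((y + b1) ^ 2 + e1) * ((y + b2) ^ 2 + e2)) :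
    ∃ t : ℝ, t ^ 2 ≤ e1 ∧ t ^ 2 ≤ e2 ∧
      (c - t * (b1 - b2)) ^ 2 = (e1 - t ^ 2) * (e2 - t ^ 2) := by
  obtain ⟨t0, ht1, ht2, ht⟩ := exists_gram_nonneg he1 he2 h
  have hmin : 0 ≤ min e1 e2 := le_min he1 he2
  have ht0 : |t0| ≤ √(min e1 e2) := Real.abs_le_sqrt (le_min ht1 ht2)
  have hzero : (e1 - √(min e1 e2) ^ 2) * (e2 - √(min e1 e2) ^ 2) = 0 := by
    rw [Real.sq_sqrt hmin]
    rcases min_choice e1 e2 with h | h <;> simp [h]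
  obtain ⟨t, htI, hg⟩ := intermediate_value_Icc' (abs_le.1 ht0).2
    (f := fun t => (e1 - t ^ 2) * (e2 - t ^ 2) - (c - t * (b1 - b2)) ^ 2)
    (by fun_prop)
    (show (0 : ℝ) ∈ Set.Icc _ _ from
      ⟨by simp only [hzero, zero_sub]; exact neg_nonpos.2 (sq_nonneg _), sub_nonneg.2 ht⟩)
  have htsq : t ^ 2 ≤ min e1 e2 := by
    rw [← Real.sq_sqrt hmin]
    exact sq_le_sq' ((abs_le.1 ht0).1.trans htI.1) htI.2
  exact ⟨t, htsq.trans (min_le_left _ _), htsq.trans (min_le_right _ _), by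
    simp only at hg; linarith⟩

theorem isSumThreeSq_biquad_one_diag {b1 b2 c11 c12 c22 : ℝ}
    (h : ∀ x1 x2 y z, 0 ≤ biquad 1 0 1 b1 0 b2 c11 c12 c22 x1 x2 y z) :
    IsSumThreeSq (biquad 1 0 1 b1 0 b2 c11 c12 c22) := by
  have hq : ∀ y, 0 ≤ (y + b1) ^ 2 + (c11 - b1 ^ 2) ∧ 0 ≤ (y + b2) ^ 2 + (c22 - b2 ^ 2) ∧
      c12 ^ 2 ≤ ((y + b1) ^ 2 + (c11 - b1 ^ 2)) * ((y + b2) ^ 2 + (c22 - b2 ^ 2)) := by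
    intro y
    rw [← qform_nonneg_iff]
    intro x1 x2
    have := h x1 x2 y 1
    simp only [biquad, qform] at this ⊢
    linarith
  obtain ⟨t, ht1, ht2, ht⟩ := exists_gram_singular (by simpa using (hq (-b1)).1)
    (by simpa using (hq (-b2)).2.1) (fun y => (hq y).2.2)
  obtain ⟨r, s, hr, hrs, hs⟩ := exists_eq_mul_of_sq_eq (sub_nonneg.2 ht1) (sub_nonneg.2 ht2) ht
  refine isSumThreeSq_of_eq 1 b1 0 t 0 (-t) 1 b2 0 r 0 s fun x1 x2 y z => ?_
  simp only [biquad, qform]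
  linear_combination x1 ^ 2 * z ^ 2 * hr + 2 * x1 * x2 * z ^ 2 * hrs + x2 ^ 2 * z ^ 2 * hs

theorem qform_nonneg_of_affine {a b c : ℝ} (h : ∀ y, 0 ≤ qform a b c y 1) (y z : ℝ) :
    0 ≤ qform a b c y z := by
  have hcont : Continuous fun z => qform a b c y z := by unfold qform; fun_prop
  refine (isClosed_le continuous_const hcont).closure_subset_iff.2 (fun z hz => ?_)
    (dense_compl_singleton (0 : ℝ) z)
  have hz : z ≠ 0 := hz
  have : qform a b c y z = z ^ 2 * qform a b c (y / z) 1 := by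
    simp only [qform]; field_simp
  rw [Set.mem_ofPred_eq, this]
  exact mul_nonneg (sq_nonneg z) (h _)

theorem isSumThreeSq_biquad_degenerate {a b11 b12 b22 c11 c12 c22 : ℝ}
    (h : ∀ x1 x2 y z, 0 ≤ biquad a 0 0 b11 b12 b22 c11 c12 c22 x1 x2 y z) :
    IsSumThreeSq (biquad a 0 0 b11 b12 b22 c11 c12 c22) := by
  obtain rfl : b22 = 0 := by
    have := (qform_nonneg_iff.1 (h 0 1)).2.2
    simp only [qform] at this
    nlinarith
  have hx : ∀ y, 0 ≤ qform a b11 c11 y 1 ∧ 0 ≤ c22 ∧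
      (2 * b12 * y + c12) ^ 2 ≤ qform a b11 c11 y 1 * c22 := by
    intro y
    rw [← qform_nonneg_iff]
    intro x1 x2
    have := h x1 x2 y 1
    simp only [biquad, qform] at this ⊢
    linarith
  obtain ⟨κ, β, γ, hκ, hβ, hγ, hq⟩ : ∃ κ β γ : ℝ, c22 = κ ^ 2 ∧ 2 * b12 = κ * β ∧ c12 = κ * γ ∧
      ∀ y, 0 ≤ qform (a - β ^ 2) (b11 - β * γ) (c11 - γ ^ 2) y 1 := by
    rcases (hx 0).2.1.eq_or_lt with h0 | hpos
    · have hlin : ∀ y, 2 * b12 * y + c12 = 0 := fun y => by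
        have := (hx y).2.2
        rw [← h0, mul_zero] at this
        exact pow_eq_zero_iff two_ne_zero |>.1 (le_antisymm this (sq_nonneg _))
      have h1 := hlin 0
      have h2 := hlin 1
      exact ⟨0, 0, 0, by simp [← h0], by linarith, by linarith, by simpa using fun y => (hx y).1⟩
    · have hsq : c22 = √c22 ^ 2 := (Real.sq_sqrt hpos.le).symm
      have hne : √c22 ≠ 0 := (Real.sqrt_pos.2 hpos).ne'
      obtain ⟨β, hβ⟩ : ∃ β, 2 * b12 = √c22 * β := ⟨2 * b12 / √c22, by field_simp⟩
      obtain ⟨γ, hγ⟩ : ∃ γ, c12 = √c22 * γ := ⟨c12 / √c22, by field_simp⟩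
      refine ⟨√c22, β, γ, hsq, hβ, hγ, fun y => nonneg_of_mul_nonneg_right ?_ hpos⟩
      have := (hx y).2.2
      rw [hβ, hγ] at this
      simp only [qform] at this ⊢
      linear_combination this + (β * y + γ) ^ 2 * hsq
  obtain ⟨ha, hc, hb⟩ := qform_nonneg_iff.1 (qform_nonneg_of_affine hq)
  obtain ⟨r, s, w, hr, hs, hw, -⟩ := exists_cholesky ha hc hb
  refine isSumThreeSq_of_eq β γ 0 κ r s 0 0 0 w 0 0 fun x1 x2 y z => ?_
  simp only [biquad, qform]
  linear_combination x1 ^ 2 * y ^ 2 * hr + 2 * x1 ^ 2 * y * z * hs + x1 ^ 2 * z ^ 2 * hw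
    + x2 ^ 2 * z ^ 2 * hκ + 2 * x1 * x2 * y * z * hβ + 2 * x1 * x2 * z ^ 2 * hγ

/-- A binary quadratic form is diagonalized by a rotation. -/
theorem exists_rotation (a b c : ℝ) :
    ∃ p q : ℝ, p ^ 2 + q ^ 2 = 1 ∧ a * p * (-q) + b * (p * p + -q * q) + c * q * p = 0 := by
  have hf : ContinuousOn (fun θ => a * Real.cos θ * (-Real.sin θ)
      + b * (Real.cos θ * Real.cos θ + -Real.sin θ * Real.sin θ)
      + c * Real.sin θ * Real.cos θ) (Set.uIcc 0 (Real.pi / 2)) := by fun_prop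
  have h0 : (0 : ℝ) ∈ Set.uIcc b (-b) := by
    rw [Set.mem_uIcc]
    rcases le_total 0 b with h | h
    · exact Or.inr ⟨by linarith, h⟩
    · exact Or.inl ⟨h, by linarith⟩
  obtain ⟨θ, -, hθ⟩ := intermediate_value_uIcc hf (by simpa using h0)
  exact ⟨Real.cos θ, Real.sin θ, Real.cos_sq_add_sin_sq θ, hθ⟩

theorem isSumThreeSq_biquad_one {b11 b12 b22 c11 c12 c22 : ℝ}
    (h : ∀ x1 x2 y z, 0 ≤ biquad 1 0 1 b11 b12 b22 c11 c12 c22 x1 x2 y z) :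
    IsSumThreeSq (biquad 1 0 1 b11 b12 b22 c11 c12 c22) := by
  obtain ⟨p, q, hpq, hoff⟩ := exists_rotation b11 b12 b22
  refine isSumThreeSq_of_comp_linear (p := p) (q := -q) (r := q) (s := p) (by nlinarith) ?_
  have h1 : qform 1 0 1 p q = 1 := by simp only [qform]; linarith
  have h2 : qform 1 0 1 (-q) p = 1 := by simp only [qform]; linarith
  have h3 : 1 * p * -q + 0 * (p * p + -q * q) + 1 * q * p = 0 := by ring
  have hF := biquad_comp_linear 1 0 1 b11 b12 b22 c11 c12 c22 p (-q) q p
  simp only [h1, h2, h3, hoff] at hF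
  simp only [hF]
  exact isSumThreeSq_biquad_one_diag fun x1 x2 y z => by rw [← hF]; exact h _ _ _ _

theorem isSumThreeSq_biquad_diag {a1 a2 b11 b12 b22 c11 c12 c22 : ℝ}
    (h : ∀ x1 x2 y z, 0 ≤ biquad a1 0 a2 b11 b12 b22 c11 c12 c22 x1 x2 y z) :
    IsSumThreeSq (biquad a1 0 a2 b11 b12 b22 c11 c12 c22) := by
  have ha1 : 0 ≤ a1 := by simpa [biquad, qform] using h 1 0 1 0
  have ha2 : 0 ≤ a2 := by simpa [biquad, qform] using h 0 1 1 0
  rcases ha2.eq_or_lt with rfl | ha2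
  · exact isSumThreeSq_biquad_degenerate h
  rcases ha1.eq_or_lt with rfl | ha1
  · refine isSumThreeSq_of_comp_linear (p := 0) (q := 1) (r := 1) (s := 0) (by norm_num) ?_
    have hF := biquad_comp_linear 0 0 a2 b11 b12 b22 c11 c12 c22 0 1 1 0
    have h1 : qform 0 0 a2 1 0 = 0 := by simp [qform]
    have h2 : (0 : ℝ) * 0 * 1 + 0 * (0 * 0 + 1 * 1) + a2 * 1 * 0 = 0 := by ring
    simp only [h1, h2] at hF
    simp only [hF]
    exact isSumThreeSq_biquad_degenerate fun x1 x2 y z => by rw [← hF]; exact h _ _ _ _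
  · have hs1 := (Real.sqrt_pos.2 ha1).ne'
    have hs2 := (Real.sqrt_pos.2 ha2).ne'
    refine isSumThreeSq_of_comp_linear (p := (√a1)⁻¹) (q := 0) (r := 0) (s := (√a2)⁻¹)
      (by simp [hs1, hs2]) ?_
    have hF := biquad_comp_linear a1 0 a2 b11 b12 b22 c11 c12 c22 (√a1)⁻¹ 0 0 (√a2)⁻¹
    have h1 : qform a1 0 a2 (√a1)⁻¹ 0 = 1 := by
      simp [qform, Real.sq_sqrt ha1.le, ha1.ne']
    have h2 : qform a1 0 a2 0 (√a2)⁻¹ = 1 := by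
      simp [qform, Real.sq_sqrt ha2.le, ha2.ne']
    have h3 : a1 * (√a1)⁻¹ * 0 + 0 * ((√a1)⁻¹ * (√a2)⁻¹ + 0 * 0) + a2 * 0 * (√a2)⁻¹ = 0 := by ring
    simp only [h1, h2, h3] at hF
    simp only [hF]
    exact isSumThreeSq_biquad_one fun x1 x2 y z => by rw [← hF]; exact h _ _ _ _

/-- A positive semidefinite 2×2 biquadratic form is a sum of three squares of bilinear forms. -/
theorem isSumThreeSq_biquad {a11 a12 a22 b11 b12 b22 c11 c12 c22 : ℝ}
    (h : ∀ x1 x2 y z, 0 ≤ biquad a11 a12 a22 b11 b12 b22 c11 c12 c22 x1 x2 y z) :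
    IsSumThreeSq (biquad a11 a12 a22 b11 b12 b22 c11 c12 c22) := by
  obtain ⟨p, q, hpq, hoff⟩ := exists_rotation a11 a12 a22
  refine isSumThreeSq_of_comp_linear (p := p) (q := -q) (r := q) (s := p) (by nlinarith) ?_
  have hF := biquad_comp_linear a11 a12 a22 b11 b12 b22 c11 c12 c22 p (-q) q p
  simp only [hoff] at hF
  simp only [hF]
  exact isSumThreeSq_biquad_diag fun x1 x2 y z => by rw [← hF]; exact h _ _ _ _

/-- The linear coefficient of a quadratic polynomial without constant term that is nonnegative
everywhere vanishes. -/
theorem linear_coeff_eq_zero {a b : ℝ} (h : ∀ t : ℝ, 0 ≤ t ^ 2 * a + t * b) : b = 0 := by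
  have := discrim_le_zero (a := a) (b := b) (c := 0) fun t => by linarith [h t]
  rw [discrim] at this
  nlinarith


/-- For a psd 2×1×1 degenerated tripartite quartic form
`h(x₁,x₂,y,z) = h₂(x₁,x₂)z² + h₃(x₁,x₂)yz + h₄(x₁,x₂)y² + h₅(x₁,x₂)yz² +
h₆(x₁,x₂)y²z + h₇y²z²` with `h₇ = 0`: the linear forms `h₅` and `h₆` vanish
identically, so `h` equals the 2×2 psd biquadratic form
`h₂(x₁,x₂)z² + h₃(x₁,x₂)yz + h₄(x₁,x₂)y²` in the blocks (x₁,x₂) and (y,z),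
and `h` is a sum of at most 3 squares of bilinear forms. -/
theorem deg211_h7_zero_case
    (b11 b12 b22 c11 c12 c22 d11 d12 d22 p1 p2 q1 q2 h7 : ℝ)
    (h : ℝ → ℝ → ℝ → ℝ → ℝ)
    (hh : ∀ x1 x2 y z, h x1 x2 y z =
      (b11 * x1 ^ 2 + b12 * (x1 * x2) + b22 * x2 ^ 2) * z ^ 2
        + (c11 * x1 ^ 2 + c12 * (x1 * x2) + c22 * x2 ^ 2) * (y * z)
        + (d11 * x1 ^ 2 + d12 * (x1 * x2) + d22 * x2 ^ 2) * y ^ 2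
        + (p1 * x1 + p2 * x2) * (y * z ^ 2)
        + (q1 * x1 + q2 * x2) * (y ^ 2 * z)
        + h7 * (y ^ 2 * z ^ 2))
    (hpsd : ∀ x1 x2 y z, 0 ≤ h x1 x2 y z)
    (h7zero : h7 = 0) :
    (∀ x1 x2 : ℝ, p1 * x1 + p2 * x2 = 0) ∧
    (∀ x1 x2 : ℝ, q1 * x1 + q2 * x2 = 0) ∧
    (∀ x1 x2 y z, h x1 x2 y z =
      (b11 * x1 ^ 2 + b12 * (x1 * x2) + b22 * x2 ^ 2) * z ^ 2
        + (c11 * x1 ^ 2 + c12 * (x1 * x2) + c22 * x2 ^ 2) * (y * z)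
        + (d11 * x1 ^ 2 + d12 * (x1 * x2) + d22 * x2 ^ 2) * y ^ 2) ∧
    (∀ x1 x2 y z : ℝ, 0 ≤
      (b11 * x1 ^ 2 + b12 * (x1 * x2) + b22 * x2 ^ 2) * z ^ 2
        + (c11 * x1 ^ 2 + c12 * (x1 * x2) + c22 * x2 ^ 2) * (y * z)
        + (d11 * x1 ^ 2 + d12 * (x1 * x2) + d22 * x2 ^ 2) * y ^ 2) ∧
    (∃ c : Fin 3 → Fin 2 → Fin 2 → ℝ,
      ∀ x1 x2 y z, h x1 x2 y z =
        ∑ t, (∑ i, ∑ k, c t i k * ![x1, x2] i * ![y, z] k) ^ 2) := by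
  subst h7zero
  have hlin : ∀ x1 x2 y z : ℝ,
      (p1 * x1 + p2 * x2) * (y * z ^ 2) + (q1 * x1 + q2 * x2) * (y ^ 2 * z) = 0 := by
    intro x1 x2 y z
    refine linear_coeff_eq_zero (a := (b11 * x1 ^ 2 + b12 * (x1 * x2) + b22 * x2 ^ 2) * z ^ 2
        + (c11 * x1 ^ 2 + c12 * (x1 * x2) + c22 * x2 ^ 2) * (y * z)
        + (d11 * x1 ^ 2 + d12 * (x1 * x2) + d22 * x2 ^ 2) * y ^ 2) fun t => ?_
    have := hpsd (t * x1) (t * x2) y z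
    rw [hh] at this
    linarith
  have hp : ∀ x1 x2 : ℝ, p1 * x1 + p2 * x2 = 0 := fun x1 x2 => by
    linarith [hlin x1 x2 1 1, hlin x1 x2 (-1) 1]
  have hq : ∀ x1 x2 : ℝ, q1 * x1 + q2 * x2 = 0 := fun x1 x2 => by
    linarith [hlin x1 x2 1 1, hlin x1 x2 (-1) 1]
  have heq : ∀ x1 x2 y z, h x1 x2 y z =
      (b11 * x1 ^ 2 + b12 * (x1 * x2) + b22 * x2 ^ 2) * z ^ 2
        + (c11 * x1 ^ 2 + c12 * (x1 * x2) + c22 * x2 ^ 2) * (y * z)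
        + (d11 * x1 ^ 2 + d12 * (x1 * x2) + d22 * x2 ^ 2) * y ^ 2 := fun x1 x2 y z => by
    rw [hh, hp, hq]; ring
  refine ⟨hp, hq, heq, fun x1 x2 y z => heq x1 x2 y z ▸ hpsd x1 x2 y z, ?_⟩
  have hbiquad : h = biquad d11 (d12 / 2) d22 (c11 / 2) (c12 / 4) (c22 / 2)
      b11 (b12 / 2) b22 := by
    funext x1 x2 y z
    rw [heq]
    simp only [biquad, qform]
    ring
  rw [hbiquad] at hpsd ⊢
  exact isSumThreeSq_biquad hpsd
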